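/- Let p be a prime number, G = ℤ/p²ℤ, H = {pj : j = 0, 1, …, p-1}, and k = p² - 1. Then θ(k, G) = 2, there exist equality cases for (k, G), and for every equality case f for (k, G) its Fourier transform has the form f̂ = α χ (δ_x - δ_y), where α ∈ ℂ is a nonzero constant, χ is a character of G (viewed as a function on G), δ_x, δ_y are indicator functions of points x, y ∈ G, and x - y ∉ H. -/

import Mathlib

open Function

/-- The Fourier transform on `ℤ/nℤ`: `f̂(y) = ∑ x, f x * e^{-2πi x y / n}`. -/
noncomputable def zdft (n : ℕ) [NeZero n] (f : ZMod n → ℂ) : ZMod n → ℂ :=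
  fun y => ∑ x : ZMod n,
    f x * Complex.exp (-2 * Real.pi * Complex.I * ((x.val * y.val : ℕ) : ℂ) / (n : ℂ))

/-- Meshulam's function `θ(k, ℤ/nℤ)`: the minimal size of the spectrum of a nonzero function
on `ℤ/nℤ` whose support has size at most `k`. -/
noncomputable def ztheta (n : ℕ) [NeZero n] (k : ℕ) : ℕ :=
  sInf {l | ∃ f : ZMod n → ℂ, f ≠ 0 ∧ (support f).ncard ≤ k ∧ (support (zdft n f)).ncard = l}

/-- An equality case for `(k, ℤ/nℤ)`: a nonzero function with support of size exactly `k`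
and spectrum of minimal size `θ(k, ℤ/nℤ)`. -/
def IsZEqualityCase (n : ℕ) [NeZero n] (k : ℕ) (f : ZMod n → ℂ) : Prop :=
  f ≠ 0 ∧ (support f).ncard = k ∧ (support (zdft n f)).ncard = ztheta n k

/-- The Fourier transform on `ZMod n` agrees with Mathlib's `ZMod.dft`. -/
lemma zdft_eq_dft {n : ℕ} [NeZero n] (f : ZMod n → ℂ) : zdft n f = ZMod.dft f := by
  funext y
  rw [ZMod.dft_apply]
  refine Finset.sum_congr rfl fun x _ => ?_
  have h : -(x * y) = ((-(x.val * y.val : ℕ) : ℤ) : ZMod n) := by simp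
  rw [h, ZMod.stdAddChar_coe, smul_eq_mul, mul_comm]
  push_cast
  ring_nf

lemma stdAddChar_mul_eq_exp {n : ℕ} [NeZero n] (c z : ZMod n) :
    ZMod.stdAddChar (c * z) =
      Complex.exp (2 * Real.pi * Complex.I * ((c.val * z.val : ℕ) : ℂ) / (n : ℂ)) := by
  have h : c * z = (((c.val * z.val : ℕ) : ℤ) : ZMod n) := by simp
  rw [h, ZMod.stdAddChar_coe]
  push_cast
  ring_nf

lemma eq_sum_zdft {n : ℕ} [NeZero n] (f : ZMod n → ℂ) (w : ZMod n) :
    f w = (n : ℂ)⁻¹ * ∑ z, ZMod.stdAddChar (z * w) * zdft n f z := by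
  have h := ZMod.invDFT_apply (zdft n f) w
  rw [zdft_eq_dft, LinearEquiv.symm_apply_apply] at h
  simpa [zdft_eq_dft] using h

/-- A function with empty spectrum vanishes. -/
lemma eq_zero_of_support_zdft_eq_empty {n : ℕ} [NeZero n] {f : ZMod n → ℂ}
    (h : support (zdft n f) = ∅) : f = 0 := by
  funext w
  rw [eq_sum_zdft f w, support_eq_empty_iff.mp h]
  simp

/-- A function with a single frequency vanishes nowhere. -/
lemma ne_zero_of_support_zdft_eq_singleton {n : ℕ} [NeZero n] {f : ZMod n → ℂ} {x : ZMod n}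
    (h : support (zdft n f) = {x}) (w : ZMod n) : f w ≠ 0 := by
  have hz : ∀ z, z ≠ x → zdft n f z = 0 := fun z hzx =>
    notMem_support.mp (by rw [h]; simpa using hzx)
  have hx : zdft n f x ≠ 0 := mem_support.mp (by rw [h]; rfl)
  rw [eq_sum_zdft f w, Finset.sum_eq_single x (fun z _ hzx => by rw [hz z hzx, mul_zero])
    (by simp)]
  exact mul_ne_zero (inv_ne_zero (NeZero.ne _))
    (mul_ne_zero (Circle.coe_ne_zero _) hx)

lemma eq_of_support_zdft_subset_pair {n : ℕ} [NeZero n] {f : ZMod n → ℂ} {x y : ZMod n}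
    (hxy : x ≠ y) (h : support (zdft n f) ⊆ {x, y}) (w : ZMod n) :
    f w = (n : ℂ)⁻¹ * (ZMod.stdAddChar (x * w) * zdft n f x +
      ZMod.stdAddChar (y * w) * zdft n f y) := by
  rw [eq_sum_zdft f w, Fintype.sum_eq_add x y hxy]
  rintro z ⟨hzx, hzy⟩
  have hz : zdft n f z = 0 := notMem_support.mp fun hz => by simpa [hzx, hzy] using h hz
  rw [hz, mul_zero]

lemma ncard_support_eq_sub_one_iff {n : ℕ} [NeZero n] {f : ZMod n → ℂ} :
    (support f).ncard = n - 1 ↔ ∃ w₀, ∀ w, f w = 0 ↔ w = w₀ := by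
  have hc := Set.ncard_add_ncard_compl (support f)
  rw [Nat.card_zmod] at hc
  have hn := NeZero.pos n
  rw [show (support f).ncard = n - 1 ↔ (support f)ᶜ.ncard = 1 by omega, Set.ncard_eq_one]
  simp [Set.ext_iff]

/-- The function with Fourier transform `δ₀ - δ₁` vanishes exactly at the origin. -/
lemma exists_ncard_support_eq_sub_one {n : ℕ} [NeZero n] (hn : 1 < n) :
    ∃ f : ZMod n → ℂ, f ≠ 0 ∧ (support f).ncard = n - 1 ∧ (support (zdft n f)).ncard = 2 := by
  have : Fact (1 < n) := ⟨hn⟩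
  set g : ZMod n → ℂ := fun z => if z = 0 then 1 else if z = 1 then -1 else 0 with hg
  obtain ⟨f, hf⟩ : ∃ f, zdft n f = g := by
    obtain ⟨f, hf⟩ := ZMod.dft.surjective g
    exact ⟨f, (zdft_eq_dft f).trans hf⟩
  have hs : support (zdft n f) = {0, 1} := by
    ext z
    rw [hf, mem_support, hg]
    by_cases h0 : z = 0 <;> by_cases h1 : z = 1 <;> simp [h0, h1]
  have h2 : (support (zdft n f)).ncard = 2 := by rw [hs, Set.ncard_pair zero_ne_one]
  refine ⟨f, ?_, ncard_support_eq_sub_one_iff.mpr ⟨0, fun w => ?_⟩, h2⟩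
  · rintro rfl
    simp [zdft_eq_dft] at h2
  · rw [eq_of_support_zdft_subset_pair zero_ne_one hs.subset w, hf]
    have h1 := ZMod.injective_stdAddChar.eq_iff (a := w) (b := 0)
    rw [AddChar.map_zero_eq_one] at h1
    simp [hg, NeZero.ne n, ← sub_eq_add_neg, sub_eq_zero, ← h1, eq_comm (a := (1 : ℂ))]

lemma ztheta_sub_one {n : ℕ} [NeZero n] (hn : 1 < n) : ztheta n (n - 1) = 2 := by
  obtain ⟨f, hf0, hf, hf2⟩ := exists_ncard_support_eq_sub_one hn
  refine le_antisymm (Nat.sInf_le ⟨f, hf0, hf.le, hf2⟩) (le_csInf ⟨2, f, hf0, hf.le, hf2⟩ ?_)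
  rintro _ ⟨g, hg0, hg, rfl⟩
  by_contra! hlt
  obtain h | h : (support (zdft n g)).ncard = 0 ∨ (support (zdft n g)).ncard = 1 := by omega
  · exact hg0 (eq_zero_of_support_zdft_eq_empty ((Set.ncard_eq_zero).mp h))
  · obtain ⟨x, hx⟩ := Set.ncard_eq_one.mp h
    have hu : support g = Set.univ :=
      Set.eq_univ_of_forall (ne_zero_of_support_zdft_eq_singleton hx)
    rw [hu, Set.ncard_univ, Nat.card_zmod] at hg
    omega

/-- A function with exactly two frequencies `x`, `y` and a zero `w₀` has Fourier transform
`α χ (δ_x - δ_y)`, and its other zeros are the `w` with `(x - y) * (w - w₀) = 0`. -/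
lemma zdft_eq_of_support_zdft_eq_pair {n : ℕ} [NeZero n] {f : ZMod n → ℂ} {x y w₀ : ZMod n}
    (hxy : x ≠ y) (h : support (zdft n f) = {x, y}) (hw₀ : f w₀ = 0) :
    (∃ α : ℂ, α ≠ 0 ∧ zdft n f = fun z => α * ZMod.stdAddChar (-w₀ * z) *
      ((if z = x then 1 else 0) - (if z = y then 1 else 0))) ∧
    ∀ w, (x - y) * (w - w₀) = 0 → f w = 0 := by
  have hx : zdft n f x ≠ 0 := mem_support.mp (by simp [h])
  have he := eq_of_support_zdft_subset_pair hxy h.subset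
  have hzero : ZMod.stdAddChar (x * w₀) * zdft n f x +
      ZMod.stdAddChar (y * w₀) * zdft n f y = 0 := by
    simpa [hw₀, NeZero.ne n] using (he w₀).symm
  have hinv : ∀ z, ZMod.stdAddChar (z * w₀) * ZMod.stdAddChar (-w₀ * z) = (1 : ℂ) := fun z => by
    rw [← AddChar.map_add_eq_mul, show z * w₀ + -w₀ * z = 0 by ring, AddChar.map_zero_eq_one]
  refine ⟨⟨ZMod.stdAddChar (x * w₀) * zdft n f x,
    mul_ne_zero (Circle.coe_ne_zero _) hx, ?_⟩, fun w hw => ?_⟩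
  · funext z
    by_cases hzx : z = x
    · subst hzx
      simp only [if_true, if_neg hxy]
      linear_combination (-zdft n f z) * hinv z
    by_cases hzy : z = y
    · subst hzy
      simp only [if_true, if_neg hxy.symm]
      linear_combination ZMod.stdAddChar (-w₀ * z) * hzero - zdft n f z * hinv z
    · rw [notMem_support.mp (by simp [h, hzx, hzy] : z ∉ support (zdft n f))]
      simp [hzx, hzy]
  · have h1 : x * w = x * w₀ + x * (w - w₀) := by ring
    have h2 : y * w = y * w₀ + x * (w - w₀) := by linear_combination -hw
    rw [he w, h1, h2, AddChar.map_add_eq_mul, AddChar.map_add_eq_mul]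
    linear_combination (n : ℂ)⁻¹ * ZMod.stdAddChar (x * (w - w₀)) * hzero

/-- For `G = ℤ/p²ℤ`, `p` prime, `H = pℤ/p²ℤ` and `k = p² - 1`: one has `θ(k, G) = 2`, there
exist equality cases for `(k, G)`, and the Fourier transform of every equality case has the
form `α χ (δ_x - δ_y)` with `α ≠ 0`, `χ : z ↦ e^{2πi c z / p²}` a character of `G`, and
`x - y ∉ H` (no `d` with `x - y = pd`). -/
theorem equality_case_p_squared_exceptional (p : ℕ) [Fact p.Prime] :
    ztheta (p ^ 2) (p ^ 2 - 1) = 2 ∧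
    (∃ f : ZMod (p ^ 2) → ℂ, IsZEqualityCase (p ^ 2) (p ^ 2 - 1) f) ∧
    (∀ f : ZMod (p ^ 2) → ℂ, IsZEqualityCase (p ^ 2) (p ^ 2 - 1) f →
      ∃ (α : ℂ) (c x y : ZMod (p ^ 2)), α ≠ 0 ∧
        (∀ d : ZMod (p ^ 2), x - y ≠ (p : ZMod (p ^ 2)) * d) ∧
        zdft (p ^ 2) f = fun z =>
          α * Complex.exp (2 * Real.pi * Complex.I * ((c.val * z.val : ℕ) : ℂ) / ((p ^ 2 : ℕ) : ℂ))
            * ((if z = x then 1 else 0) - (if z = y then 1 else 0))) := by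
  have hp : 1 < p := (Fact.out : p.Prime).one_lt
  have hn : 1 < p ^ 2 := Nat.one_lt_pow two_ne_zero hp
  have hθ := ztheta_sub_one hn
  obtain ⟨f₀, hf₀, hf₀s, hf₀t⟩ := exists_ncard_support_eq_sub_one hn
  refine ⟨hθ, ⟨f₀, hf₀, hf₀s, hf₀t.trans hθ.symm⟩, ?_⟩
  rintro f ⟨-, hfs, hft⟩
  obtain ⟨w₀, hw₀⟩ := ncard_support_eq_sub_one_iff.mp hfs
  obtain ⟨x, y, hxy, hs⟩ := Set.ncard_eq_two.mp (hft.trans hθ)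
  obtain ⟨⟨α, hα, hf⟩, hz⟩ := zdft_eq_of_support_zdft_eq_pair hxy hs ((hw₀ w₀).mpr rfl)
  refine ⟨α, -w₀, x, y, hα, fun d hd => ?_, ?_⟩
  · have hpp : (p : ZMod (p ^ 2)) * p = 0 := by
      rw [← Nat.cast_mul, ← sq, ZMod.natCast_self]
    have h := (hw₀ (w₀ + p)).mp (hz _ (by rw [hd]; linear_combination d * hpp))
    rw [add_eq_left, ZMod.natCast_eq_zero_iff] at h
    exact absurd (Nat.le_of_dvd (by omega) h) (by nlinarith)
  · rw [hf]
    simp only [stdAddChar_mul_eq_exp]
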